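/- Assume ω ∈ ℝ^r satisfies the Diophantine condition with constants c_D > 0 and ν > 0. Let 0 ≤ κ₋ < κ₊, M > 0, c ∈ (0,1), ε > 0. Let a : [0,∞) → End(X) be sharp-flat of class κ₊ with 𝒩_{κ₊}(a) ≤ M, and let φ : [0,∞) → End(X) be sharp-flat of class κ₊ with ⟨φ⟩ = id and 𝒩_{κ₊}(φ − id) ≤ c. Then Λ{φ}_τ := a_τφ_τ − φ_τ⟨aφ⟩ has zero time average, the primitive τ ↦ ∫_0^τ Λ{φ}_σ dσ admits a time average, and the map φ'_τ := id + ε∫_0^τ Λ{φ}_σ dσ − ε⟨∫_0^• Λ{φ}_σ dσ⟩ is sharp-flat of class κ₋ with ⟨φ'⟩ = id and 𝒩_{κ₋}(φ' − id) ≤ ε · c_I(κ₊ − κ₋) · (2+c)(1+c) M, where c_I(κ) = max{1, (1/c_D)(ν/(κe))^ν}. -/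

import Mathlib

open scoped BigOperators
open Filter MeasureTheory

noncomputable section

variable {X : Type*} [NormedAddCommGroup X] [NormedSpace ℂ X] [CompleteSpace X]

/-- `|α| = |α₁| + ⋯ + |α_r|` for a multi-index `α ∈ ℤ^r`. -/
def absIdx {r : ℕ} (α : Fin r → ℤ) : ℝ := ∑ i, |(α i : ℝ)|

/-- `α · ω = α₁ω₁ + ⋯ + α_rω_r`. -/
def dotIdx {r : ℕ} (ω : Fin r → ℝ) (α : Fin r → ℤ) : ℝ := ∑ i, (α i : ℝ) * ω i

/-- The quasi-periodic ("sharp") map generated by a family of Fourier coefficients: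
`τ ↦ Σ_α e^{i(α·ω)τ} φ̂_α`. -/
def sharpSum {r : ℕ} (ω : Fin r → ℝ) (φhat : (Fin r → ℤ) → (X →L[ℂ] X)) (τ : ℝ) :
    X →L[ℂ] X :=
  ∑' α : Fin r → ℤ, Complex.exp (Complex.I * (dotIdx ω α : ℂ) * (τ : ℂ)) • φhat α

/-- The weighted ℓ¹-norm `Σ_α e^{κ|α|} ‖φ̂_α‖` of a family of Fourier coefficients. -/
def sharpNorm {r : ℕ} (κ : ℝ) (φhat : (Fin r → ℤ) → (X →L[ℂ] X)) : ℝ :=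
  ∑' α : Fin r → ℤ, Real.exp (κ * absIdx α) * ‖φhat α‖

/-- `sup_{τ ≥ 0} e^τ ‖φ♭_τ‖` for the exponentially decaying ("flat") part. -/
def flatSup (φflat : ℝ → (X →L[ℂ] X)) : ℝ :=
  ⨆ τ : Set.Ici (0:ℝ), Real.exp (τ : ℝ) * ‖φflat (τ : ℝ)‖

/-- The sharp-flat norm `𝒩_κ(φ) = Σ_α e^{κ|α|}‖φ̂_α‖ + sup_{τ≥0} e^τ‖φ♭_τ‖`. -/
def SFNorm {r : ℕ} (κ : ℝ) (φhat : (Fin r → ℤ) → (X →L[ℂ] X))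
    (φflat : ℝ → (X →L[ℂ] X)) : ℝ :=
  sharpNorm κ φhat + flatSup φflat

/-- `φ : [0,∞) → End(X)` is sharp-flat of class `κ`, with sharp Fourier coefficients
`φhat` and flat part `φflat`. -/
structure IsSharpFlat {r : ℕ} (ω : Fin r → ℝ) (κ : ℝ) (φ : ℝ → (X →L[ℂ] X))
    (φhat : (Fin r → ℤ) → (X →L[ℂ] X)) (φflat : ℝ → (X →L[ℂ] X)) : Prop where
  summable : Summable fun α : Fin r → ℤ => Real.exp (κ * absIdx α) * ‖φhat α‖
  flat_cont : ContinuousOn φflat (Set.Ici 0)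
  flat_bdd : BddAbove (Set.range fun τ : Set.Ici (0:ℝ) => Real.exp (τ : ℝ) * ‖φflat (τ : ℝ)‖)
  decomp : ∀ τ : ℝ, 0 ≤ τ → φ τ = sharpSum ω φhat τ + φflat τ

/-- The time average `⟨φ⟩ = lim_{T→∞} (1/T) ∫₀^T φ_σ dσ` equals `B`. -/
def HasTimeAvg {E : Type*} [NormedAddCommGroup E] [NormedSpace ℝ E] (φ : ℝ → E) (B : E) : Prop :=
  Tendsto (fun T : ℝ => (1 / T) • ∫ σ in (0:ℝ)..T, φ σ) atTop (nhds B)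

/-- The constant `c_I(κ) = max{1, (1/c_D)(ν/(κe))^ν}` from the integration lemma. -/
def cI (c_D ν κ : ℝ) : ℝ := max 1 ((1 / c_D) * (ν / (κ * Real.exp 1)) ^ ν)


section helpers

set_option linter.unusedSectionVars false

variable {r : ℕ} {ω : Fin r → ℝ}

lemma norm_expI (d τ : ℝ) : ‖Complex.exp (Complex.I * (d : ℂ) * (τ : ℂ))‖ = 1 := by
  have : Complex.I * (d : ℂ) * (τ : ℂ) = ((d * τ : ℝ) : ℂ) * Complex.I := by push_cast; ring
  rw [this, Complex.norm_exp_ofReal_mul_I]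

lemma absIdx_nonneg (α : Fin r → ℤ) : 0 ≤ absIdx α :=
  Finset.sum_nonneg fun _ _ => abs_nonneg _

lemma absIdx_add (α β : Fin r → ℤ) : absIdx (α + β) ≤ absIdx α + absIdx β := by
  unfold absIdx
  rw [← Finset.sum_add_distrib]
  refine Finset.sum_le_sum fun i _ => ?_
  push_cast [Pi.add_apply]
  exact abs_add_le _ _

lemma absIdx_zero : absIdx (0 : Fin r → ℤ) = 0 := by simp [absIdx]

lemma dotIdx_zero : dotIdx ω 0 = 0 := by simp [dotIdx]

lemma dotIdx_add (α β : Fin r → ℤ) : dotIdx ω (α + β) = dotIdx ω α + dotIdx ω β := by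
  simp [dotIdx, add_mul, Finset.sum_add_distrib]

lemma absIdx_pos {α : Fin r → ℤ} (h : α ≠ 0) : 0 < absIdx α := by
  obtain ⟨i, hi⟩ := Function.ne_iff.1 h
  refine Finset.sum_pos' (fun _ _ => abs_nonneg _) ⟨i, Finset.mem_univ _, ?_⟩
  have : (α i : ℝ) ≠ 0 := by exact_mod_cast hi
  positivity

lemma one_le_w {κ : ℝ} (hκ : 0 ≤ κ) (α : Fin r → ℤ) : 1 ≤ Real.exp (κ * absIdx α) :=
  Real.one_le_exp (mul_nonneg hκ (absIdx_nonneg α))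

lemma summable_norm_of_w {κ : ℝ} (hκ : 0 ≤ κ) {h : (Fin r → ℤ) → (X →L[ℂ] X)}
    (hs : Summable fun α => Real.exp (κ * absIdx α) * ‖h α‖) : Summable fun α => ‖h α‖ :=
  hs.of_nonneg_of_le (fun _ => norm_nonneg _)
    fun α => le_mul_of_one_le_left (norm_nonneg _) (one_le_w hκ α)

lemma tsum_norm_le_sharpNorm {κ : ℝ} (hκ : 0 ≤ κ) {h : (Fin r → ℤ) → (X →L[ℂ] X)}
    (hs : Summable fun α => Real.exp (κ * absIdx α) * ‖h α‖) :
    ∑' α, ‖h α‖ ≤ sharpNorm κ h :=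
  (summable_norm_of_w hκ hs).tsum_le_tsum
    (fun α => le_mul_of_one_le_left (norm_nonneg _) (one_le_w hκ α)) hs

lemma norm_term (h : (Fin r → ℤ) → (X →L[ℂ] X)) (τ : ℝ) (α : Fin r → ℤ) :
    ‖Complex.exp (Complex.I * (dotIdx ω α : ℂ) * (τ : ℂ)) • h α‖ = ‖h α‖ := by
  rw [norm_smul, norm_expI, one_mul]

lemma summable_term {h : (Fin r → ℤ) → (X →L[ℂ] X)} (hs : Summable fun α => ‖h α‖) (τ : ℝ) :
    Summable fun α => Complex.exp (Complex.I * (dotIdx ω α : ℂ) * (τ : ℂ)) • h α :=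
  Summable.of_norm (by simpa only [norm_term] using hs)

lemma norm_sharpSum_le {h : (Fin r → ℤ) → (X →L[ℂ] X)} (hs : Summable fun α => ‖h α‖) (τ : ℝ) :
    ‖sharpSum ω h τ‖ ≤ ∑' α, ‖h α‖ :=
  tsum_of_norm_bounded hs.hasSum fun α => (norm_term h τ α).le

lemma continuous_sharpSum {h : (Fin r → ℤ) → (X →L[ℂ] X)} (hs : Summable fun α => ‖h α‖) :
    Continuous (sharpSum ω h) :=
  continuous_tsum (fun α => by fun_prop) hs fun α τ => (norm_term h τ α).le

lemma integral_sharpSum {h : (Fin r → ℤ) → (X →L[ℂ] X)} (hs : Summable fun α => ‖h α‖) (T : ℝ) :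
    ∫ σ in (0:ℝ)..T, sharpSum ω h σ =
      ∑' α, (∫ σ in (0:ℝ)..T, Complex.exp (Complex.I * (dotIdx ω α : ℂ) * (σ : ℂ))) • h α := by
  have := intervalIntegral.hasSum_integral_of_dominated_convergence (μ := volume) (a := 0) (b := T)
    (F := fun α σ => Complex.exp (Complex.I * (dotIdx ω α : ℂ) * (σ : ℂ)) • h α)
    (f := sharpSum ω h) (fun α _ => ‖h α‖)
    (fun α => (Continuous.aestronglyMeasurable (by fun_prop)))
    (fun α => Eventually.of_forall fun σ _ => (norm_term h σ α).le)
    (Eventually.of_forall fun σ _ => hs)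
    (by simp)
    (Eventually.of_forall fun σ _ => (summable_term hs σ).hasSum)
  rw [← this.tsum_eq]
  congr 1; ext1 α
  exact intervalIntegral.integral_smul_const _ _

lemma flat_le {κ : ℝ} {φ f : ℝ → (X →L[ℂ] X)} {h : (Fin r → ℤ) → (X →L[ℂ] X)}
    (hφ : IsSharpFlat ω κ φ h f) {τ : ℝ} (hτ : 0 ≤ τ) : Real.exp τ * ‖f τ‖ ≤ flatSup f :=
  le_ciSup hφ.flat_bdd ⟨τ, hτ⟩

lemma flatSup_le {f : ℝ → (X →L[ℂ] X)} {C : ℝ} (h : ∀ τ, 0 ≤ τ → Real.exp τ * ‖f τ‖ ≤ C) :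
    flatSup f ≤ C :=
  haveI : Nonempty (Set.Ici (0:ℝ)) := ⟨⟨0, Set.mem_Ici.2 le_rfl⟩⟩
  ciSup_le fun τ => h τ τ.2

lemma bdd_of {f : ℝ → (X →L[ℂ] X)} {C : ℝ} (h : ∀ τ, 0 ≤ τ → Real.exp τ * ‖f τ‖ ≤ C) :
    BddAbove (Set.range fun τ : Set.Ici (0:ℝ) => Real.exp (τ : ℝ) * ‖f (τ : ℝ)‖) :=
  ⟨C, by rintro _ ⟨τ, rfl⟩; exact h τ τ.2⟩

lemma flatSup_nonneg (f : ℝ → (X →L[ℂ] X)) : 0 ≤ flatSup f :=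
  Real.iSup_nonneg fun _ => by positivity

lemma sharpNorm_nonneg (κ : ℝ) (h : (Fin r → ℤ) → (X →L[ℂ] X)) : 0 ≤ sharpNorm κ h :=
  tsum_nonneg fun _ => by positivity

lemma norm_flat_le {κ : ℝ} {φ f : ℝ → (X →L[ℂ] X)} {h : (Fin r → ℤ) → (X →L[ℂ] X)}
    (hφ : IsSharpFlat ω κ φ h f) {τ : ℝ} (hτ : 0 ≤ τ) :
    ‖f τ‖ ≤ flatSup f * Real.exp (-τ) := by
  have := flat_le hφ hτ
  rw [Real.exp_neg, ← div_eq_mul_inv, le_div_iff₀ (Real.exp_pos _), mul_comm]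
  exact this

/-- the flat part extended continuously -/
lemma flat_ext {κ : ℝ} {φ f : ℝ → (X →L[ℂ] X)} {h : (Fin r → ℤ) → (X →L[ℂ] X)}
    (hφ : IsSharpFlat ω κ φ h f) : Continuous fun τ => f (max τ 0) :=
  hφ.flat_cont.comp_continuous (by fun_prop) fun τ => Set.mem_Ici.2 (le_max_right _ _)

lemma integral_sf {κ : ℝ} (hκ : 0 ≤ κ) {φ f : ℝ → (X →L[ℂ] X)} {h : (Fin r → ℤ) → (X →L[ℂ] X)}
    (hφ : IsSharpFlat ω κ φ h f) {T : ℝ} (hT : 0 ≤ T) :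
    ∫ σ in (0:ℝ)..T, φ σ =
      (∑' α, (∫ σ in (0:ℝ)..T, Complex.exp (Complex.I * (dotIdx ω α : ℂ) * (σ : ℂ))) • h α)
      + ∫ σ in (0:ℝ)..T, f (max σ 0) := by
  have hs := summable_norm_of_w hκ hφ.summable
  rw [← integral_sharpSum hs, ← intervalIntegral.integral_add
    ((continuous_sharpSum hs).intervalIntegrable _ _) ((flat_ext hφ).intervalIntegrable _ _)]
  refine intervalIntegral.integral_congr fun σ hσ => ?_
  rw [Set.uIcc_of_le hT] at hσ
  simp only [max_eq_left hσ.1]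
  exact hφ.decomp σ hσ.1

lemma flat_integrable {κ : ℝ} {φ f : ℝ → (X →L[ℂ] X)} {h : (Fin r → ℤ) → (X →L[ℂ] X)}
    (hφ : IsSharpFlat ω κ φ h f) {τ : ℝ} (hτ : 0 ≤ τ) :
    IntegrableOn (fun σ => f (max σ 0)) (Set.Ioi τ) := by
  refine Integrable.mono' ((integrableOn_exp_neg_Ioi τ).const_mul (flatSup f))
    (flat_ext hφ).aestronglyMeasurable ?_
  refine (ae_restrict_mem measurableSet_Ioi).mono fun σ hσ => ?_
  have : 0 ≤ σ := hτ.trans (le_of_lt hσ)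
  rw [max_eq_left this]
  exact norm_flat_le hφ this

lemma flat_tail {κ : ℝ} {φ f : ℝ → (X →L[ℂ] X)} {h : (Fin r → ℤ) → (X →L[ℂ] X)}
    (hφ : IsSharpFlat ω κ φ h f) {τ : ℝ} (hτ : 0 ≤ τ) :
    ‖∫ σ in Set.Ioi τ, f (max σ 0)‖ ≤ flatSup f * Real.exp (-τ) := by
  rw [← integral_exp_neg_Ioi, ← integral_const_mul]
  refine norm_integral_le_of_norm_le ((integrableOn_exp_neg_Ioi τ).const_mul (flatSup f)) ?_
  refine (ae_restrict_mem measurableSet_Ioi).mono fun σ hσ => ?_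
  have : 0 ≤ σ := hτ.trans (le_of_lt hσ)
  rw [max_eq_left this]
  exact norm_flat_le hφ this

lemma hasTimeAvg_sf (hω : ∀ α, α ≠ 0 → dotIdx ω α ≠ 0) {κ : ℝ} (hκ : 0 ≤ κ)
    {φ f : ℝ → (X →L[ℂ] X)} {h : (Fin r → ℤ) → (X →L[ℂ] X)}
    (hφ : IsSharpFlat ω κ φ h f) : HasTimeAvg φ (h 0) := by
  have hs := summable_norm_of_w hκ hφ.summable
  have key : Tendsto (fun T : ℝ => (∑' α, ((1 / T) • ∫ σ in (0:ℝ)..T,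
      Complex.exp (Complex.I * (dotIdx ω α : ℂ) * (σ : ℂ))) • h α)
      + (1 / T) • ∫ σ in (0:ℝ)..T, f (max σ 0)) atTop
      (nhds ((∑' α : Fin r → ℤ, (if α = 0 then h 0 else 0)) + 0)) := by
    have hinv : Tendsto (fun T : ℝ => 1 / T) atTop (nhds 0) := by
      simpa using tendsto_inv_atTop_zero (𝕜 := ℝ)
    refine Tendsto.add ?_ ?_
    · refine tendsto_tsum_of_dominated_convergence (G := X →L[ℂ] X) (bound := fun α => ‖h α‖) hs ?_ ?_
      · intro α
        by_cases hα : α = 0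
        · subst hα
          rw [if_pos rfl]
          refine tendsto_const_nhds.congr' ?_
          filter_upwards [eventually_gt_atTop 0] with T hT
          simp [dotIdx_zero, hT.ne']
        · rw [if_neg hα]
          have hc : Complex.I * (dotIdx ω α : ℂ) ≠ 0 :=
            mul_ne_zero Complex.I_ne_zero (by exact_mod_cast hω α hα)
          rw [← zero_smul ℂ (h α)]
          refine Tendsto.smul_const ?_ _
          refine squeeze_zero_norm (a := fun T : ℝ => |1 / T| * (2 / ‖Complex.I * (dotIdx ω α : ℂ)‖)) ?_ ?_
          · intro T
            rw [norm_smul, integral_exp_mul_complex hc, Real.norm_eq_abs, norm_div]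
            have h2 : ‖Complex.exp (Complex.I * (dotIdx ω α : ℂ) * (T : ℂ)) -
                Complex.exp (Complex.I * (dotIdx ω α : ℂ) * ((0 : ℝ) : ℂ))‖ ≤ 2 := by
              refine (norm_sub_le _ _).trans ?_
              rw [norm_expI, norm_expI]; norm_num
            gcongr
          · simpa using hinv.abs.mul_const (2 / ‖Complex.I * (dotIdx ω α : ℂ)‖)
      · filter_upwards [eventually_gt_atTop 0] with T hT α
        rw [norm_smul]
        refine mul_le_of_le_one_left (norm_nonneg _) ?_
        rw [norm_smul]
        have := intervalIntegral.norm_integral_le_of_norm_le_const (a := 0) (b := T) (C := 1)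
          (f := fun σ : ℝ => Complex.exp (Complex.I * (dotIdx ω α : ℂ) * (σ : ℂ)))
          fun σ _ => (norm_expI _ _).le
        rw [sub_zero, one_mul, abs_of_pos hT] at this
        rw [Real.norm_eq_abs, abs_of_pos (by positivity)]
        calc _ ≤ 1 / T * T := by gcongr
          _ = 1 := by field_simp
    · rw [← zero_smul ℝ (∫ σ in Set.Ioi (0:ℝ), f (max σ 0))]
      exact hinv.smul (intervalIntegral_tendsto_integral_Ioi 0 (flat_integrable hφ le_rfl) tendsto_id)
  rw [tsum_ite_eq, add_zero] at key
  refine key.congr' ?_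
  filter_upwards [eventually_gt_atTop 0] with T hT
  rw [integral_sf hκ hφ hT.le, smul_add, ← tsum_const_smul'']
  congr 2
  ext1 α
  rw [smul_assoc]

/-- convolution of Fourier coefficients -/
def convHat (h g : (Fin r → ℤ) → (X →L[ℂ] X)) (α : Fin r → ℤ) : X →L[ℂ] X :=
  ∑' β, h β * g (α - β)

/-- shear equivalence -/
def shearEquiv (r : ℕ) : ((Fin r → ℤ) × (Fin r → ℤ)) ≃ ((Fin r → ℤ) × (Fin r → ℤ)) where
  toFun p := (p.2, p.1 - p.2)
  invFun p := (p.1 + p.2, p.1)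
  left_inv p := by simp
  right_inv p := by simp

lemma conv_main {κ : ℝ} (hκ : 0 ≤ κ) {h g : (Fin r → ℤ) → (X →L[ℂ] X)}
    (hh : Summable fun α => Real.exp (κ * absIdx α) * ‖h α‖)
    (hg : Summable fun α => Real.exp (κ * absIdx α) * ‖g α‖) :
    (Summable fun α => Real.exp (κ * absIdx α) * ‖convHat h g α‖) ∧
    sharpNorm κ (convHat h g) ≤ sharpNorm κ h * sharpNorm κ g := by
  have hP : Summable fun p : (Fin r → ℤ) × (Fin r → ℤ) =>
      (Real.exp (κ * absIdx p.1) * ‖h p.1‖) * (Real.exp (κ * absIdx p.2) * ‖g p.2‖) :=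
    hh.mul_of_nonneg hg (fun _ => by positivity) (fun _ => by positivity)
  have hPe := (shearEquiv r).summable_iff.2 hP
  have hle : ∀ p : (Fin r → ℤ) × (Fin r → ℤ),
      Real.exp (κ * absIdx p.1) * (‖h p.2‖ * ‖g (p.1 - p.2)‖) ≤
      (Real.exp (κ * absIdx p.2) * ‖h p.2‖) *
        (Real.exp (κ * absIdx (p.1 - p.2)) * ‖g (p.1 - p.2)‖) := by
    intro p
    have h1 : Real.exp (κ * absIdx p.1) ≤
        Real.exp (κ * absIdx p.2) * Real.exp (κ * absIdx (p.1 - p.2)) := by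
      rw [← Real.exp_add, ← mul_add]
      have := absIdx_add p.2 (p.1 - p.2)
      rw [add_sub_cancel] at this
      gcongr
    calc _ ≤ Real.exp (κ * absIdx p.2) * Real.exp (κ * absIdx (p.1 - p.2)) *
          (‖h p.2‖ * ‖g (p.1 - p.2)‖) := by gcongr
      _ = _ := by ring
  have hQ : Summable fun p : (Fin r → ℤ) × (Fin r → ℤ) =>
      Real.exp (κ * absIdx p.1) * (‖h p.2‖ * ‖g (p.1 - p.2)‖) :=
    hPe.of_nonneg_of_le (fun _ => by positivity) hle
  have hb : ∀ α, Summable fun β => ‖h β‖ * ‖g (α - β)‖ := fun α =>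
    (summable_mul_left_iff (Real.exp_pos (κ * absIdx α)).ne').1 (hQ.prod_factor α)
  have hc : ∀ α, Real.exp (κ * absIdx α) * ‖convHat h g α‖ ≤
      ∑' β, Real.exp (κ * absIdx α) * (‖h β‖ * ‖g (α - β)‖) := by
    intro α
    rw [tsum_mul_left]
    gcongr
    exact tsum_of_norm_bounded (hb α).hasSum fun β => norm_mul_le _ _
  have hs : Summable fun α => Real.exp (κ * absIdx α) * ‖convHat h g α‖ :=
    hQ.prod.of_nonneg_of_le (fun _ => by positivity) hc
  refine ⟨hs, ?_⟩
  calc sharpNorm κ (convHat h g) ≤ ∑' α, ∑' β, Real.exp (κ * absIdx α) * (‖h β‖ * ‖g (α - β)‖) :=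
        hs.tsum_le_tsum hc hQ.prod
    _ = ∑' p : (Fin r → ℤ) × (Fin r → ℤ),
        Real.exp (κ * absIdx p.1) * (‖h p.2‖ * ‖g (p.1 - p.2)‖) := hQ.tsum_prod.symm
    _ ≤ _ := hQ.tsum_le_tsum hle hPe
    _ = _ := (shearEquiv r).tsum_eq (fun p : (Fin r → ℤ) × (Fin r → ℤ) =>
      (Real.exp (κ * absIdx p.1) * ‖h p.1‖) * (Real.exp (κ * absIdx p.2) * ‖g p.2‖))
    _ = _ := (hh.tsum_mul_tsum hg hP).symm

lemma sharpSum_conv {h g : (Fin r → ℤ) → (X →L[ℂ] X)}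
    (hh : Summable fun α => ‖h α‖) (hg : Summable fun α => ‖g α‖) (τ : ℝ) :
    sharpSum ω (convHat h g) τ = sharpSum ω h τ * sharpSum ω g τ := by
  have h1 : Summable fun α => ‖Complex.exp (Complex.I * (dotIdx ω α : ℂ) * (τ : ℂ)) • h α‖ := by
    simpa only [norm_term] using hh
  have h2 : Summable fun α => ‖Complex.exp (Complex.I * (dotIdx ω α : ℂ) * (τ : ℂ)) • g α‖ := by
    simpa only [norm_term] using hg
  have hS := (shearEquiv r).summable_iff.2 (summable_mul_of_summable_norm h1 h2)
  unfold sharpSum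
  rw [tsum_mul_tsum_of_summable_norm h1 h2, ← (shearEquiv r).tsum_eq]
  refine Eq.trans ?_ (Summable.tsum_prod hS).symm
  congr 1; ext1 α
  unfold convHat
  rw [← tsum_const_smul'']
  congr 1; ext1 β
  simp only [shearEquiv, Equiv.coe_fn_mk, Function.comp_apply]
  rw [smul_mul_smul_comm, ← Complex.exp_add]
  congr 2
  have : dotIdx ω α = dotIdx ω β + dotIdx ω (α - β) := by rw [← dotIdx_add, add_sub_cancel]
  rw [this]; push_cast; ring

lemma sf_mul {κ : ℝ} (hκ : 0 ≤ κ) {φ f ψ k : ℝ → (X →L[ℂ] X)} {h g : (Fin r → ℤ) → (X →L[ℂ] X)}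
    (hφ : IsSharpFlat ω κ φ h f) (hψ : IsSharpFlat ω κ ψ g k) :
    ∃ q, IsSharpFlat ω κ (fun τ => φ τ * ψ τ) (convHat h g) q ∧
      SFNorm κ (convHat h g) q ≤ SFNorm κ h f * SFNorm κ g k := by
  have hh := summable_norm_of_w hκ hφ.summable
  have hg := summable_norm_of_w hκ hψ.summable
  obtain ⟨hs, hn⟩ := conv_main hκ hφ.summable hψ.summable
  have hb : ∀ τ, 0 ≤ τ → Real.exp τ * ‖sharpSum ω h τ * k τ + f τ * sharpSum ω g τ + f τ * k τ‖ ≤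
      sharpNorm κ h * flatSup k + flatSup f * sharpNorm κ g + flatSup f * flatSup k := by
    intro τ hτ
    have a1 := (norm_sharpSum_le (ω := ω) hh τ).trans (tsum_norm_le_sharpNorm hκ hφ.summable)
    have a2 := (norm_sharpSum_le (ω := ω) hg τ).trans (tsum_norm_le_sharpNorm hκ hψ.summable)
    have b1 := flat_le hφ hτ
    have b2 := flat_le hψ hτ
    have b3 : ‖k τ‖ ≤ flatSup k :=
      (le_mul_of_one_le_left (norm_nonneg _) (Real.one_le_exp hτ)).trans b2
    calc _ ≤ Real.exp τ * (‖sharpSum ω h τ‖ * ‖k τ‖ + ‖f τ‖ * ‖sharpSum ω g τ‖ + ‖f τ‖ * ‖k τ‖) := by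
          gcongr
          exact norm_add₃_le.trans (add_le_add_three (norm_mul_le _ _) (norm_mul_le _ _)
            (norm_mul_le _ _))
      _ = ‖sharpSum ω h τ‖ * (Real.exp τ * ‖k τ‖) + (Real.exp τ * ‖f τ‖) * ‖sharpSum ω g τ‖ +
          (Real.exp τ * ‖f τ‖) * ‖k τ‖ := by ring
      _ ≤ _ := by
          have := flatSup_nonneg f
          have := sharpNorm_nonneg κ h
          gcongr
  refine ⟨fun τ => sharpSum ω h τ * k τ + f τ * sharpSum ω g τ + f τ * k τ,
    ⟨hs, ?_, bdd_of (f := fun τ => sharpSum ω h τ * k τ + f τ * sharpSum ω g τ + f τ * k τ) hb, ?_⟩, ?_⟩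
  · have c1 := (continuous_sharpSum (ω := ω) hh).continuousOn (s := Set.Ici 0)
    have c2 := (continuous_sharpSum (ω := ω) hg).continuousOn (s := Set.Ici 0)
    exact ((c1.mul hψ.flat_cont).add (hφ.flat_cont.mul c2)).add (hφ.flat_cont.mul hψ.flat_cont)
  · intro τ hτ
    rw [hφ.decomp τ hτ, hψ.decomp τ hτ, sharpSum_conv hh hg]
    noncomm_ring
  · have := flatSup_le (f := fun τ => sharpSum ω h τ * k τ + f τ * sharpSum ω g τ + f τ * k τ) hb
    unfold SFNorm
    nlinarith

lemma sf_mul_const {κ : ℝ} (hκ : 0 ≤ κ) {φ f : ℝ → (X →L[ℂ] X)} {h : (Fin r → ℤ) → (X →L[ℂ] X)}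
    (hφ : IsSharpFlat ω κ φ h f) (B : X →L[ℂ] X) :
    IsSharpFlat ω κ (fun τ => φ τ * B) (fun α => h α * B) (fun τ => f τ * B) ∧
      SFNorm κ (fun α => h α * B) (fun τ => f τ * B) ≤ SFNorm κ h f * ‖B‖ := by
  have hle : ∀ α, Real.exp (κ * absIdx α) * ‖h α * B‖ ≤
      Real.exp (κ * absIdx α) * ‖h α‖ * ‖B‖ := fun α => by
    rw [mul_assoc]; gcongr; exact norm_mul_le _ _
  have hs : Summable fun α => Real.exp (κ * absIdx α) * ‖h α * B‖ :=
    (hφ.summable.mul_right ‖B‖).of_nonneg_of_le (fun _ => by positivity) hle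
  have hb : ∀ τ, 0 ≤ τ → Real.exp τ * ‖f τ * B‖ ≤ flatSup f * ‖B‖ := fun τ hτ => by
    calc _ ≤ Real.exp τ * (‖f τ‖ * ‖B‖) := by gcongr; exact norm_mul_le _ _
      _ = Real.exp τ * ‖f τ‖ * ‖B‖ := by ring
      _ ≤ _ := by gcongr; exact flat_le hφ hτ
  refine ⟨⟨hs, hφ.flat_cont.mul continuousOn_const, bdd_of (f := fun τ => f τ * B) hb, ?_⟩, ?_⟩
  · intro τ hτ
    rw [hφ.decomp τ hτ, add_mul]
    congr 1
    unfold sharpSum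
    rw [← (summable_term (summable_norm_of_w hκ hφ.summable) τ).tsum_mul_right]
    simp only [smul_mul_assoc]
  · have h1 := flatSup_le (f := fun τ => f τ * B) hb
    have h2 : sharpNorm κ (fun α => h α * B) ≤ sharpNorm κ h * ‖B‖ := by
      unfold sharpNorm
      rw [← tsum_mul_right]
      exact hs.tsum_le_tsum hle (hφ.summable.mul_right _)
    unfold SFNorm
    linarith

lemma sf_add {κ : ℝ} (hκ : 0 ≤ κ) {φ f ψ k : ℝ → (X →L[ℂ] X)} {h g : (Fin r → ℤ) → (X →L[ℂ] X)}
    (hφ : IsSharpFlat ω κ φ h f) (hψ : IsSharpFlat ω κ ψ g k) :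
    IsSharpFlat ω κ (fun τ => φ τ + ψ τ) (fun α => h α + g α) (fun τ => f τ + k τ) ∧
      SFNorm κ (fun α => h α + g α) (fun τ => f τ + k τ) ≤ SFNorm κ h f + SFNorm κ g k := by
  have hle : ∀ α, Real.exp (κ * absIdx α) * ‖h α + g α‖ ≤
      Real.exp (κ * absIdx α) * ‖h α‖ + Real.exp (κ * absIdx α) * ‖g α‖ := fun α => by
    rw [← mul_add]; gcongr; exact norm_add_le _ _
  have hs : Summable fun α => Real.exp (κ * absIdx α) * ‖h α + g α‖ :=
    (hφ.summable.add hψ.summable).of_nonneg_of_le (fun _ => by positivity) hle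
  have hb : ∀ τ, 0 ≤ τ → Real.exp τ * ‖f τ + k τ‖ ≤ flatSup f + flatSup k := fun τ hτ => by
    calc _ ≤ Real.exp τ * (‖f τ‖ + ‖k τ‖) := by gcongr; exact norm_add_le _ _
      _ = Real.exp τ * ‖f τ‖ + Real.exp τ * ‖k τ‖ := by ring
      _ ≤ _ := add_le_add (flat_le hφ hτ) (flat_le hψ hτ)
  refine ⟨⟨hs, hφ.flat_cont.add hψ.flat_cont, bdd_of (f := fun τ => f τ + k τ) hb, ?_⟩, ?_⟩
  · intro τ hτ
    have : sharpSum ω (fun α => h α + g α) τ = sharpSum ω h τ + sharpSum ω g τ := by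
      unfold sharpSum
      rw [← (summable_term (summable_norm_of_w hκ hφ.summable) τ).tsum_add
        (summable_term (summable_norm_of_w hκ hψ.summable) τ)]
      simp only [smul_add]
    rw [hφ.decomp τ hτ, hψ.decomp τ hτ, this]
    abel
  · have h1 := flatSup_le (f := fun τ => f τ + k τ) hb
    have h2 : sharpNorm κ (fun α => h α + g α) ≤ sharpNorm κ h + sharpNorm κ g := by
      unfold sharpNorm
      rw [← hφ.summable.tsum_add hψ.summable]
      exact hs.tsum_le_tsum hle (hφ.summable.add hψ.summable)
    unfold SFNorm
    linarith

lemma sf_const (κ : ℝ) (K : X →L[ℂ] X) :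
    IsSharpFlat ω κ (fun _ => K) (fun α => if α = 0 then K else 0) (fun _ => 0) ∧
      SFNorm κ (fun α : Fin r → ℤ => if α = 0 then K else 0) (fun _ => 0) = ‖K‖ := by
  have e : (fun α : Fin r → ℤ => Real.exp (κ * absIdx α) * ‖if α = 0 then K else 0‖) =
      fun α => if α = 0 then ‖K‖ else 0 := by
    ext1 α
    split_ifs with h
    · subst h; simp [absIdx_zero]
    · simp
  refine ⟨⟨?_, continuousOn_const, bdd_of (f := fun _ => (0 : X →L[ℂ] X)) (C := 0) (by simp), ?_⟩, ?_⟩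
  · rw [e]; exact (hasSum_ite_eq 0 ‖K‖).summable
  · intro τ _
    unfold sharpSum
    rw [tsum_eq_single 0 (fun α hα => by simp [hα])]
    simp [dotIdx_zero]
  · unfold SFNorm sharpNorm
    rw [e, tsum_ite_eq]
    simp [flatSup]

lemma max_bound {c_D ν δ d n : ℝ} (hcD : 0 < c_D) (hν : 0 < ν) (hδ : 0 < δ) (hn : 0 < n)
    (hd : c_D / n ^ ν ≤ d) : d⁻¹ ≤ cI c_D ν δ * Real.exp (δ * n) := by
  have hnν : 0 < n ^ ν := Real.rpow_pos_of_pos hn _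
  have h1 : d⁻¹ ≤ n ^ ν / c_D := by
    rw [← inv_div]
    exact inv_anti₀ (by positivity) hd
  have h2 : n ^ ν ≤ (ν / (δ * Real.exp 1)) ^ ν * Real.exp (δ * n) := by
    have h3 : n ≤ (ν / (δ * Real.exp 1)) * Real.exp (δ * n / ν) := by
      have := Real.add_one_le_exp (δ * n / ν - 1)
      rw [Real.exp_sub, sub_add_cancel] at this
      have h4 : n = (ν / δ) * (δ * n / ν) := by field_simp
      calc n = (ν / δ) * (δ * n / ν) := h4
        _ ≤ (ν / δ) * (Real.exp (δ * n / ν) / Real.exp 1) := by gcongr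
        _ = _ := by field_simp
    calc n ^ ν ≤ ((ν / (δ * Real.exp 1)) * Real.exp (δ * n / ν)) ^ ν := by gcongr
      _ = _ := by
        rw [Real.mul_rpow (by positivity) (by positivity), ← Real.exp_mul]
        congr 2; field_simp
  calc d⁻¹ ≤ n ^ ν / c_D := h1
    _ ≤ ((ν / (δ * Real.exp 1)) ^ ν * Real.exp (δ * n)) / c_D := by gcongr
    _ = ((1 / c_D) * (ν / (δ * Real.exp 1)) ^ ν) * Real.exp (δ * n) := by ring
    _ ≤ _ := by gcongr; exact le_max_right _ _

lemma sf_primitive {c_D ν : ℝ} (hcD : 0 < c_D) (hν : 0 < ν)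
    (hdio : ∀ α : Fin r → ℤ, α ≠ 0 → c_D / (absIdx α) ^ ν ≤ |dotIdx ω α|)
    {κm κp : ℝ} (h0 : 0 ≤ κm) (hκ : κm < κp) (ε : ℝ) (hε : 0 < ε)
    {φ f : ℝ → (X →L[ℂ] X)} {h : (Fin r → ℤ) → (X →L[ℂ] X)}
    (hφ : IsSharpFlat ω κp φ h f) (hh0 : h 0 = 0) :
    ∃ (P : X →L[ℂ] X) (J : (Fin r → ℤ) → (X →L[ℂ] X)) (G : ℝ → (X →L[ℂ] X)), J 0 = 0 ∧
      IsSharpFlat ω κm (fun τ => ε • ((∫ σ in (0:ℝ)..τ, φ σ) - P)) J G ∧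
      SFNorm κm J G ≤ ε * cI c_D ν (κp - κm) * SFNorm κp h f := by
  have hκp : 0 ≤ κp := h0.trans hκ.le
  have hsh := summable_norm_of_w hκp hφ.summable
  set C := cI c_D ν (κp - κm) with hC
  have hC1 : 1 ≤ C := le_max_left _ _
  set J : (Fin r → ℤ) → (X →L[ℂ] X) := fun α => (Complex.I * (dotIdx ω α : ℂ))⁻¹ • h α with hJ
  have hJ0 : J 0 = 0 := by simp [hJ, hh0]
  have hle : ∀ α, Real.exp (κm * absIdx α) * ‖J α‖ ≤ C * (Real.exp (κp * absIdx α) * ‖h α‖) := by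
    intro α
    by_cases hα : α = 0
    · subst hα; rw [hJ0, norm_zero, mul_zero]; positivity
    · have := max_bound hcD hν (sub_pos.2 hκ) (absIdx_pos hα) (hdio α hα)
      rw [hJ]
      simp only [norm_smul, norm_inv, norm_mul, Complex.norm_I, one_mul, Complex.norm_real,
        Real.norm_eq_abs]
      have e : Real.exp (κp * absIdx α) =
          Real.exp (κm * absIdx α) * Real.exp ((κp - κm) * absIdx α) := by
        rw [← Real.exp_add]; ring_nf
      calc _ ≤ Real.exp (κm * absIdx α) * ((C * Real.exp ((κp - κm) * absIdx α)) * ‖h α‖) := by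
            gcongr
        _ = _ := by rw [e]; ring
  have hs : Summable fun α => Real.exp (κm * absIdx α) * ‖J α‖ :=
    (hφ.summable.mul_left C).of_nonneg_of_le (fun _ => by positivity) hle
  have hJs := summable_norm_of_w h0 hs
  set P : X →L[ℂ] X := (∫ σ in Set.Ioi (0:ℝ), f (max σ 0)) - ∑' α, J α with hP
  have hprim : ∀ τ, 0 ≤ τ → (∫ σ in (0:ℝ)..τ, φ σ) - P = sharpSum ω J τ +
      ((∫ σ in (0:ℝ)..τ, f (max σ 0)) - ∫ σ in Set.Ioi (0:ℝ), f (max σ 0)) := by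
    intro τ hτ
    rw [integral_sf hκp hφ hτ]
    have e : (∑' α, (∫ σ in (0:ℝ)..τ,
        Complex.exp (Complex.I * (dotIdx ω α : ℂ) * (σ : ℂ))) • h α) =
        sharpSum ω J τ - ∑' α, J α := by
      unfold sharpSum
      rw [← (summable_term hJs τ).tsum_sub hJs.of_norm]
      congr 1; ext1 α
      by_cases hα : α = 0
      · subst hα; rw [hJ0, hh0]; simp
      · have hd : dotIdx ω α ≠ 0 := by
          have h1 := hdio α hα
          have h2 : 0 < c_D / absIdx α ^ ν :=
            div_pos hcD (Real.rpow_pos_of_pos (absIdx_pos hα) _)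
          exact abs_pos.1 (h2.trans_le h1)
        have hc : Complex.I * (dotIdx ω α : ℂ) ≠ 0 :=
          mul_ne_zero Complex.I_ne_zero (by exact_mod_cast hd)
        rw [integral_exp_mul_complex hc]
        simp only [hJ, smul_smul, ← sub_smul, Complex.ofReal_zero, mul_zero, Complex.exp_zero]
        rw [div_eq_mul_inv, sub_mul, sub_smul, one_mul, sub_smul]
    rw [e, hP]
    abel
  have hb : ∀ τ, 0 ≤ τ → Real.exp τ * ‖ε • ((∫ σ in (0:ℝ)..τ, f (max σ 0)) -
      ∫ σ in Set.Ioi (0:ℝ), f (max σ 0))‖ ≤ ε * flatSup f := by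
    intro τ hτ
    have h1 := flat_tail hφ hτ
    rw [← intervalIntegral.integral_interval_add_Ioi (flat_integrable hφ le_rfl)
      (flat_integrable hφ hτ), sub_add_cancel_left, norm_smul, norm_neg, Real.norm_eq_abs,
      abs_of_pos hε]
    calc _ ≤ Real.exp τ * (ε * (flatSup f * Real.exp (-τ))) := by gcongr
      _ = ε * flatSup f * (Real.exp τ * Real.exp (-τ)) := by ring
      _ = _ := by rw [← Real.exp_add]; simp
  have hle' : ∀ α, Real.exp (κm * absIdx α) * ‖ε • J α‖ ≤
      ε * C * (Real.exp (κp * absIdx α) * ‖h α‖) := by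
    intro α
    rw [norm_smul, Real.norm_eq_abs, abs_of_pos hε]
    calc _ = ε * (Real.exp (κm * absIdx α) * ‖J α‖) := by ring
      _ ≤ ε * (C * (Real.exp (κp * absIdx α) * ‖h α‖)) := mul_le_mul_of_nonneg_left (hle α) hε.le
      _ = _ := by ring
  have hs' : Summable fun α => Real.exp (κm * absIdx α) * ‖ε • J α‖ :=
    (hφ.summable.mul_left (ε * C)).of_nonneg_of_le (fun _ => by positivity) hle'
  refine ⟨P, fun α => ε • J α, fun τ => ε • ((∫ σ in (0:ℝ)..τ, f (max σ 0)) - ∫ σ in Set.Ioi (0:ℝ), f (max σ 0)), by simp [hJ0], ⟨hs', ?_, bdd_of (f := fun τ => ε • ((∫ σ in (0:ℝ)..τ, f (max σ 0)) - ∫ σ in Set.Ioi (0:ℝ), f (max σ 0))) hb, ?_⟩, ?_⟩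
  · refine Continuous.continuousOn ?_
    exact ((intervalIntegral.continuous_primitive
      (fun a b => (flat_ext hφ).intervalIntegrable a b) 0).sub continuous_const).const_smul ε
  · intro τ hτ
    rw [hprim τ hτ, smul_add]
    congr 1
    unfold sharpSum
    rw [← tsum_const_smul'']
    congr 1; ext1 α
    exact smul_comm _ _ _
  · have h1 := flatSup_le (f := fun τ => ε • ((∫ σ in (0:ℝ)..τ, f (max σ 0)) - ∫ σ in Set.Ioi (0:ℝ), f (max σ 0))) hb
    have h2 : sharpNorm κm (fun α => ε • J α) ≤ ε * C * sharpNorm κp h := by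
      unfold sharpNorm
      rw [← tsum_mul_left]
      exact hs'.tsum_le_tsum hle' (hφ.summable.mul_left _)
    have h3 : ε * flatSup f ≤ ε * C * flatSup f := by
      have := flatSup_nonneg f
      gcongr
      exact le_mul_of_one_le_right hε.le hC1
    unfold SFNorm
    linarith

end helpers

/-- one step of the averaging fixed-point iteration. Under the
Diophantine condition, if `a` is sharp-flat of class `κ₊` with `𝒩_{κ₊}(a) ≤ M`, and `φ`
is sharp-flat of class `κ₊` with `⟨φ⟩ = id` and `𝒩_{κ₊}(φ − id) ≤ c`, then `Λ{φ}` has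
zero time average, its primitive admits a time average, and
`φ'_τ = id + ε∫₀^τ Λ{φ} − ε⟨∫₀^• Λ{φ}⟩` is sharp-flat of class `κ₋` with `⟨φ'⟩ = id`
and `𝒩_{κ₋}(φ' − id) ≤ ε c_I(κ₊−κ₋) (2+c)(1+c) M`. -/
theorem averaging_iteration_step
    {r : ℕ} (ω : Fin r → ℝ) (c_D ν : ℝ) (hcD : 0 < c_D) (hν : 0 < ν)
    (hdio : ∀ α : Fin r → ℤ, α ≠ 0 → c_D / (absIdx α) ^ ν ≤ |dotIdx ω α|)
    {κm κp : ℝ} (h0 : 0 ≤ κm) (hκ : κm < κp)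
    (M c ε : ℝ) (hM : 0 < M) (hc0 : 0 < c) (hc1 : c < 1) (hε : 0 < ε)
    (a : ℝ → (X →L[ℂ] X))
    (ahat : (Fin r → ℤ) → (X →L[ℂ] X)) (aflat : ℝ → (X →L[ℂ] X))
    (ha : IsSharpFlat ω κp a ahat aflat) (haM : SFNorm κp ahat aflat ≤ M)
    (φ : ℝ → (X →L[ℂ] X))
    (φhat : (Fin r → ℤ) → (X →L[ℂ] X)) (φflat : ℝ → (X →L[ℂ] X))
    (hφ : IsSharpFlat ω κp φ φhat φflat)
    (hφavg : HasTimeAvg φ 1)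
    (hφc : SFNorm κp (fun α => if α = 0 then φhat 0 - 1 else φhat α) φflat ≤ c) :
    ∃ B : X →L[ℂ] X,
      HasTimeAvg (fun τ => a τ ∘L φ τ) B ∧
      HasTimeAvg (fun τ => a τ ∘L φ τ - φ τ ∘L B) 0 ∧
      ∃ Pavg : X →L[ℂ] X,
        HasTimeAvg (fun τ => ∫ σ in (0:ℝ)..τ, (a σ ∘L φ σ - φ σ ∘L B)) Pavg ∧
        ∃ (φ'hat : (Fin r → ℤ) → (X →L[ℂ] X)) (φ'flat : ℝ → (X →L[ℂ] X)),
          IsSharpFlat ω κm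
            (fun τ => 1 + ε • ((∫ σ in (0:ℝ)..τ, (a σ ∘L φ σ - φ σ ∘L B)) - Pavg))
            φ'hat φ'flat ∧
          HasTimeAvg
            (fun τ => 1 + ε • ((∫ σ in (0:ℝ)..τ, (a σ ∘L φ σ - φ σ ∘L B)) - Pavg)) 1 ∧
          SFNorm κm (fun α => if α = 0 then φ'hat 0 - 1 else φ'hat α) φ'flat ≤
            ε * cI c_D ν (κp - κm) * ((2 + c) * (1 + c) * M) := by
  have hκp : 0 ≤ κp := h0.trans hκ.le
  have hω : ∀ α, α ≠ 0 → dotIdx ω α ≠ 0 := fun α hα =>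
    abs_pos.1 ((div_pos hcD (Real.rpow_pos_of_pos (absIdx_pos hα) _)).trans_le (hdio α hα))
  have hφ0 : φhat 0 = 1 := tendsto_nhds_unique (hasTimeAvg_sf hω hκp hφ) hφavg
  -- norm of φ
  have hφN : SFNorm κp φhat φflat ≤ 1 + c := by
    set g : (Fin r → ℤ) → (X →L[ℂ] X) := fun α => if α = 0 then φhat 0 - 1 else φhat α with hg
    have hgs : Summable fun α => Real.exp (κp * absIdx α) * ‖g α‖ := by
      refine hφ.summable.of_nonneg_of_le (fun _ => by positivity) fun α => ?_
      gcongr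
      by_cases hα : α = 0
      · simp [hg, hα, hφ0]
      · simp [hg, hα]
    have h1 : IsSharpFlat ω κp (fun τ => sharpSum ω g τ + φflat τ) g φflat :=
      ⟨hgs, hφ.flat_cont, hφ.flat_bdd, fun _ _ => rfl⟩
    obtain ⟨h2, h3⟩ := sf_const (ω := ω) κp (1 : X →L[ℂ] X)
    have h4 := (sf_add hκp h1 h2).2
    have e1 : (fun α => g α + if α = 0 then (1 : X →L[ℂ] X) else 0) = φhat := by
      ext1 α
      by_cases hα : α = 0
      · simp [hg, hα]
      · simp [hg, hα]
    have e2 : (fun τ => φflat τ + 0) = φflat := by simp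
    rw [e1, e2, h3] at h4
    have h5 : ‖(1 : X →L[ℂ] X)‖ ≤ 1 := ContinuousLinearMap.norm_id_le
    linarith
  obtain ⟨q, hq, hqN⟩ := sf_mul hκp ha hφ
  set p := convHat ahat φhat with hp
  have hN0 : 0 ≤ SFNorm κp φhat φflat := add_nonneg (sharpNorm_nonneg _ _) (flatSup_nonneg _)
  have hqN' : SFNorm κp p q ≤ M * (1 + c) :=
    hqN.trans (mul_le_mul haM hφN hN0 hM.le)
  have hB : ‖p 0‖ ≤ M * (1 + c) := by
    have h1 := hq.summable.le_tsum 0 (fun _ _ => by positivity)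
    rw [absIdx_zero, mul_zero, Real.exp_zero, one_mul] at h1
    have h2 := flatSup_nonneg q
    have h3 : ‖p 0‖ + flatSup q ≤ SFNorm κp p q := add_le_add h1 le_rfl
    linarith
  obtain ⟨hb, hbN⟩ := sf_mul_const hκp hφ (-(p 0))
  obtain ⟨hL, hLN⟩ := sf_add hκp hq hb
  have eL : (fun τ => a τ * φ τ + φ τ * -(p 0)) = fun τ => a τ ∘L φ τ - φ τ ∘L (p 0) := by
    ext1 τ
    rw [mul_neg, ← sub_eq_add_neg]
    rfl
  rw [eL] at hL
  have hL0 : p 0 + φhat 0 * -(p 0) = 0 := by rw [hφ0, one_mul, add_neg_cancel]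
  have hLN' : SFNorm κp (fun α => p α + φhat α * -(p 0)) (fun τ => q τ + φflat τ * -(p 0)) ≤
      (2 + c) * (1 + c) * M := by
    refine hLN.trans ?_
    rw [norm_neg] at hbN
    have : SFNorm κp φhat φflat * ‖p 0‖ ≤ (1 + c) * (M * (1 + c)) := by gcongr
    nlinarith
  obtain ⟨P, J, G, hJ0, hJ, hJN⟩ := sf_primitive hcD hν hdio h0 hκ ε hε hL hL0
  refine ⟨p 0, hasTimeAvg_sf hω hκp hq, ?_, P, ?_, ?_⟩
  · have := hasTimeAvg_sf hω hκp hL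
    rwa [hL0] at this
  · have hPP : HasTimeAvg (fun τ => ε⁻¹ • (ε • ((∫ σ in (0:ℝ)..τ,
        (a σ ∘L φ σ - φ σ ∘L (p 0))) - P)) + P) P := by
      have h1 : IsSharpFlat ω κm (fun τ => ε • ((∫ σ in (0:ℝ)..τ,
          (a σ ∘L φ σ - φ σ ∘L (p 0))) - P) + ε • P) _ _ :=
        (sf_add h0 hJ (sf_const (ω := ω) κm (ε • P)).1).1
      have h2 := (hasTimeAvg_sf hω h0 h1).const_smul ε⁻¹
      simp only [hJ0, if_true, zero_add, smul_smul, inv_mul_cancel₀ hε.ne', one_smul] at h2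
      refine h2.congr fun T => ?_
      rw [mul_comm, ← smul_smul, ← intervalIntegral.integral_smul]
      congr 2
      ext1 τ
      rw [smul_add, smul_smul ε⁻¹ ε P, inv_mul_cancel₀ hε.ne', one_smul]
    simpa [smul_smul, inv_mul_cancel₀ hε.ne'] using hPP
  · obtain ⟨h2, h3⟩ := sf_const (ω := ω) κm (1 : X →L[ℂ] X)
    have h4 := (sf_add h0 h2 hJ).1
    refine ⟨_, _, h4, ?_, ?_⟩
    · have := hasTimeAvg_sf hω h0 h4
      rwa [hJ0, if_pos rfl, add_zero] at this
    · have e1 : (fun α : Fin r → ℤ => if α = 0 then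
          ((if (0 : Fin r → ℤ) = 0 then (1 : X →L[ℂ] X) else 0) + J 0) - 1 else
          (if α = 0 then (1 : X →L[ℂ] X) else 0) + J α) = J := by
        ext1 α
        by_cases hα : α = 0
        · simp [hα, hJ0]
        · simp [hα]
      have e2 : (fun τ => 0 + G τ) = G := by simp
      rw [e1, e2]
      refine hJN.trans ?_
      have : 0 ≤ cI c_D ν (κp - κm) := zero_le_one.trans (le_max_left _ _)
      gcongr
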